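/- Fix η ∈ (0,1), ε > 0, D ≥ 1, and channels W₁, …, W_D from 𝒳 to finite output alphabets 𝒴₁, …, 𝒴_D. Then there exists a constant Γ > 0 such that for all sufficiently large n and every nonempty A ⊆ 𝒳ⁿ, there exists a partition A = ⋃_{k=1}^{m} A_k into pairwise disjoint nonempty sets with m ≤ n·Γ such that for every k ∈ [1,m]: (1) when Xⁿ is uniformly distributed on A, the conditional entropy of Xⁿ given Xⁿ ∈ A_k equals log₂|A_k|; and (2) for every i ∈ [1,D], |(1/n)·H(P^{(i)}_{A_k}) − (1/n)·log₂ g^n_i(A_k, η)| ≤ ε. -/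

import Mathlib

open scoped BigOperators Classical
open Finset Real

noncomputable section

/-- The `n`-fold product channel: `Wⁿ(yⁿ|xⁿ) = ∏ⱼ W(yⱼ|xⱼ)`. -/
def prodW {X Y : Type*} (W : X → Y → ℝ) {n : ℕ} (x : Fin n → X) (y : Fin n → Y) : ℝ :=
  ∏ j, W (x j) (y j)

/-- Probability `Wⁿ(B|xⁿ)` of an output set `B` given input `xⁿ`. -/
def prodWSet {X Y : Type*} (W : X → Y → ℝ) {n : ℕ} (x : Fin n → X)
    (B : Finset (Fin n → Y)) : ℝ :=
  ∑ y ∈ B, prodW W x y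

/-- Output distribution `P_A` of `Wⁿ` with uniformly distributed input on `A`. -/
def outDist {X Y : Type*} (W : X → Y → ℝ) {n : ℕ}
    (A : Finset (Fin n → X)) (y : Fin n → Y) : ℝ :=
  (A.card : ℝ)⁻¹ * ∑ x ∈ A, prodW W x y

/-- `W` is a channel: each row is a probability distribution on `Y`. -/
def isChannel {X Y : Type*} [Fintype Y] (W : X → Y → ℝ) : Prop :=
  ∀ x, (∀ y, 0 ≤ W x y) ∧ ∑ y, W x y = 1

/-- `K_δ = ⌈(log₂ |𝒴|)/δ⌉`. -/
def Kdel (c : ℕ) (δ : ℝ) : ℕ := ⌈Real.logb 2 c / δ⌉₊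

/-- The sets `B_k` of the `δ`-information-spectrum partition of `𝒴ⁿ` w.r.t. the
information spectrum `i_n(yⁿ) = -(1/n) log₂ p(yⁿ)`:  membership `kδ ≤ i_n(yⁿ) < (k+1)δ`
(resp. `Kδ ≤ i_n(yⁿ) < ∞` for `k = K`) is expressed directly in terms of `p`. -/
def specSet {Y : Type*} [Fintype Y] {n : ℕ} (p : (Fin n → Y) → ℝ)
    (δ : ℝ) (K k : ℕ) : Finset (Fin n → Y) :=
  if k < K then
    Finset.univ.filter fun y =>
      (2:ℝ) ^ (-((n:ℝ) * ((k:ℝ)+1) * δ)) < p y ∧ p y ≤ (2:ℝ) ^ (-((n:ℝ) * (k:ℝ) * δ))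
  else
    Finset.univ.filter fun y => 0 < p y ∧ p y ≤ (2:ℝ) ^ (-((n:ℝ) * (K:ℝ) * δ))

/-- `ḡⁿ(A,η)`: minimum cardinality of an `η`-quasi-image of `A` over `Wⁿ`. -/
def gbar {X Y : Type*} [Fintype Y] (W : X → Y → ℝ) {n : ℕ}
    (A : Finset (Fin n → X)) (η : ℝ) : ℕ :=
  sInf {m | ∃ B : Finset (Fin n → Y), B.card = m ∧ η ≤ ∑ y ∈ B, outDist W A y}

/-- `gⁿ(A,η)`: minimum cardinality of an `η`-image of `A` over `Wⁿ`. -/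
def gimg {X Y : Type*} [Fintype Y] (W : X → Y → ℝ) {n : ℕ}
    (A : Finset (Fin n → X)) (η : ℝ) : ℕ :=
  sInf {m | ∃ B : Finset (Fin n → Y), B.card = m ∧ ∀ x ∈ A, η ≤ prodWSet W x B}

/-- Shannon entropy (base 2) of a distribution `q` on a finite set. -/
def ent {Z : Type*} [Fintype Z] (q : Z → ℝ) : ℝ :=
  -∑ z, q z * Real.logb 2 (q z)

end

/-- The conditional distribution of `Xⁿ` (uniform on `A`) given `Xⁿ ∈ A_k` for `A_k ⊆ A`:
the uniform distribution on `A_k`. -/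
noncomputable def condUnif {X : Type*} [Fintype X] {n : ℕ} (A' : Finset (Fin n → X)) :
    (Fin n → X) → ℝ :=
  fun x => if x ∈ A' then ((A'.card : ℝ))⁻¹ else 0

theorem sum_mul_sum_le_of_mul_le {Y : Type*} [Fintype Y] {Λ C : ℝ} (hΛ : 1 ≤ Λ)
    {w f h : Y → ℝ} (hw : ∀ y, 0 ≤ w y) (hw1 : ∑ y, w y = 1)
    (hf : ∀ y, 0 ≤ f y) (hh : ∀ y, 0 ≤ h y) (hC : 0 ≤ C)
    (hfh : ∀ y z, f y * h z ≤ C * if y = z then 1 else Λ) :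
    (∑ y, w y * f y) * (∑ y, w y * h y) ≤ C * ((1 + Λ) ^ 2 / (4 * Λ)) := by
  have hΛ0 : 0 < Λ := by linarith
  have hne : Nonempty Y := by
    by_contra hY
    rw [not_nonempty_iff] at hY
    simp at hw1
  obtain ⟨a, ha⟩ := Finite.exists_max f
  have hm0 : 0 ≤ ∑ y, w y * f y := Finset.sum_nonneg fun y _ => mul_nonneg (hw y) (hf y)
  rcases (hf a).eq_or_lt with h0 | hM
  · have : ∑ y, w y * f y = 0 :=
      Finset.sum_eq_zero fun y _ => by rw [le_antisymm (h0 ▸ ha y) (hf y), mul_zero]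
    rw [this, zero_mul]
    positivity
  set M := f a
  have hpt : ∀ y, h y * (M * M) ≤ C * ((1 + Λ) * M - Λ * f y) := by
    intro y
    have h1 : f y * h y ≤ C := by simpa using hfh y y
    have h2 : M * h y ≤ C * Λ := by
      refine (hfh a y).trans (mul_le_mul_of_nonneg_left ?_ hC)
      split_ifs <;> linarith
    rcases le_total (Λ * f y) M with hy | hy
    · nlinarith [mul_le_mul_of_nonneg_left h2 hM.le, mul_le_mul_of_nonneg_left hy hC]
    · have hfy : 0 < f y := by
        rcases (hf y).eq_or_lt with h | h
        · rw [← h] at hy; linarith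
        · exact h
      have h3 : M * M ≤ f y * ((1 + Λ) * M - Λ * f y) := by
        nlinarith [mul_nonneg (sub_nonneg.2 (ha y)) (sub_nonneg.2 hy)]
      have h4 : 0 ≤ (1 + Λ) * M - Λ * f y := by nlinarith [ha y]
      nlinarith [mul_le_mul_of_nonneg_left h3 (hh y), mul_le_mul_of_nonneg_right h1 h4]
  set m := ∑ y, w y * f y
  set e := ∑ y, w y * h y
  have hsum : e * (M * M) ≤ C * ((1 + Λ) * M - Λ * m) := by
    calc e * (M * M) = ∑ y, w y * (h y * (M * M)) := by
          simp only [e, Finset.sum_mul, mul_assoc]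
      _ ≤ ∑ y, w y * (C * ((1 + Λ) * M - Λ * f y)) :=
          Finset.sum_le_sum fun y _ => mul_le_mul_of_nonneg_left (hpt y) (hw y)
      _ = ∑ y, (w y * (C * ((1 + Λ) * M)) - C * Λ * (w y * f y)) :=
          Finset.sum_congr rfl fun y _ => by ring
      _ = C * ((1 + Λ) * M - Λ * m) := by
          rw [Finset.sum_sub_distrib, ← Finset.sum_mul, ← Finset.mul_sum, hw1]
          ring
  rw [← mul_div_assoc, le_div_iff₀ (by positivity)]
  refine le_of_mul_le_mul_right ?_ (mul_pos hM hM)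
  have h5 := mul_le_mul_of_nonneg_left hsum (mul_nonneg (mul_nonneg zero_le_four hΛ0.le) hm0)
  nlinarith [mul_nonneg hC (sq_nonneg ((1 + Λ) * M - 2 * Λ * m))]

theorem sum_fin_succ_arrow {Y : Type*} [Fintype Y] {n : ℕ} (F : (Fin (n + 1) → Y) → ℝ) :
    ∑ y, F y = ∑ a, ∑ y : Fin n → Y, F (Fin.cons a y) := by
  rw [← (Fin.consEquiv fun _ : Fin (n + 1) => Y).sum_comp, Fintype.sum_prod_type]
  rfl

/-- Tensorized concentration inequality for pairs of functions on a product space. -/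
theorem sum_prod_mul_sum_prod_le {Y : Type*} [Fintype Y] {Λ : ℝ} (hΛ : 1 ≤ Λ) {n : ℕ}
    {w : Fin n → Y → ℝ} (hw : ∀ j y, 0 ≤ w j y) (hw1 : ∀ j, ∑ y, w j y = 1)
    {f h : (Fin n → Y) → ℝ} (hf : ∀ y, 0 ≤ f y) (hh : ∀ y, 0 ≤ h y) {C : ℝ} (hC : 0 ≤ C)
    (hfh : ∀ y z, f y * h z ≤ C * ∏ j, if y j = z j then 1 else Λ) :
    (∑ y, (∏ j, w j (y j)) * f y) * (∑ y, (∏ j, w j (y j)) * h y) ≤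
      C * ((1 + Λ) ^ 2 / (4 * Λ)) ^ n := by
  induction n generalizing C with
  | zero => simpa using hfh default default
  | succ n ih =>
    have hK : 0 ≤ (1 + Λ) ^ 2 / (4 * Λ) := by positivity
    have hcons : ∀ f : (Fin (n + 1) → Y) → ℝ, ∑ y, (∏ j, w j (y j)) * f y =
        ∑ a, w 0 a * ∑ y : Fin n → Y, (∏ j, w j.succ (y j)) * f (Fin.cons a y) := by
      intro f
      simp_rw [sum_fin_succ_arrow, Fin.prod_univ_succ, Fin.cons_zero, Fin.cons_succ,
        Finset.mul_sum, mul_assoc]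
    have hnn : ∀ f : (Fin (n + 1) → Y) → ℝ, (∀ y, 0 ≤ f y) → ∀ a,
        0 ≤ ∑ y : Fin n → Y, (∏ j, w j.succ (y j)) * f (Fin.cons a y) := fun f hf a =>
      Finset.sum_nonneg fun y _ =>
        mul_nonneg (Finset.prod_nonneg fun j _ => hw _ _) (hf _)
    rw [hcons f, hcons h, pow_succ, ← mul_assoc]
    refine sum_mul_sum_le_of_mul_le hΛ (hw 0) (hw1 0) (hnn f hf) (hnn h hh)
      (mul_nonneg hC (pow_nonneg hK n)) fun a b => ?_
    have hD : 0 ≤ C * if a = b then 1 else Λ := by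
      refine mul_nonneg hC ?_
      split_ifs <;> linarith
    refine (ih (w := fun j => w j.succ) (fun j => hw _) (fun j => hw1 _) (fun y => hf _)
      (fun y => hh _) hD fun y z => ?_).trans_eq (by ring)
    simpa [Fin.prod_univ_succ, mul_assoc] using hfh (Fin.cons a y) (Fin.cons b z)

theorem prod_ite_eq_pow_hammingDist {Y : Type*} {n : ℕ} (y z : Fin n → Y) (s : ℝ) :
    (∏ j, if y j = z j then 1 else s) = s ^ hammingDist y z := by
  simp [hammingDist, Finset.prod_ite]

theorem sum_pow_hammingDist_le {Y : Type*} [Fintype Y] {n : ℕ} (y : Fin n → Y) {s : ℝ}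
    (hs : 0 ≤ s) : ∑ z, s ^ hammingDist y z ≤ Real.exp (n * (Fintype.card Y * s)) := by
  simp_rw [← prod_ite_eq_pow_hammingDist]
  have h1 := Finset.prod_univ_sum (fun _ : Fin n => (Finset.univ : Finset Y))
    (fun j a => if y j = a then 1 else s)
  rw [Fintype.piFinset_univ] at h1
  rw [← h1, Real.exp_nat_mul]
  calc ∏ j, ∑ a, (if y j = a then 1 else s)
      ≤ ∏ _j : Fin n, Real.exp (Fintype.card Y * s) := by
        refine Finset.prod_le_prod (fun j _ => Finset.sum_nonneg fun a _ => ?_) fun j _ => ?_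
        · split_ifs <;> positivity
        · calc ∑ a, (if y j = a then 1 else s) ≤ ∑ a, ((if y j = a then 1 else 0) + s) := by
                refine Finset.sum_le_sum fun a _ => ?_
                split_ifs <;> linarith
            _ = Fintype.card Y * s + 1 := by
                simp [Finset.sum_add_distrib, add_comm]
            _ ≤ _ := Real.add_one_le_exp _
    _ = _ := by simp

/-- The closed Hamming neighbourhood of radius `r` of a set of words. -/
noncomputable def hammingBlowup {Y : Type*} [Fintype Y] {n : ℕ} (B : Finset (Fin n → Y)) (r : ℝ) :
    Finset (Fin n → Y) :=
  Finset.univ.filter fun z => ∃ y ∈ B, (hammingDist y z : ℝ) ≤ r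

theorem card_hammingBlowup_le {Y : Type*} [Fintype Y] {n : ℕ} (B : Finset (Fin n → Y))
    (r : ℝ) {a : ℝ} (ha : 0 ≤ a) :
    ((hammingBlowup B r).card : ℝ) ≤
      Real.exp (a * r + n * (Fintype.card Y * Real.exp (-a))) * B.card := by
  have hpow : ∀ k : ℕ, Real.exp (-a) ^ k = Real.exp (-(a * k)) := fun k => by
    rw [← Real.exp_nat_mul]; ring_nf
  calc ((hammingBlowup B r).card : ℝ) = ∑ z ∈ hammingBlowup B r, (1 : ℝ) := by simp
    _ ≤ ∑ z ∈ hammingBlowup B r, ∑ y ∈ B, Real.exp (a * r) * Real.exp (-a) ^ hammingDist y z := by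
        refine Finset.sum_le_sum fun z hz => ?_
        obtain ⟨y, hy, hyz⟩ := (Finset.mem_filter.1 hz).2
        refine le_trans ?_ (Finset.single_le_sum
          (f := fun y => Real.exp (a * r) * Real.exp (-a) ^ hammingDist y z)
          (fun y _ => by positivity) hy)
        simp only [hpow, ← Real.exp_add]
        exact Real.one_le_exp (by nlinarith)
    _ ≤ ∑ z, ∑ y ∈ B, Real.exp (a * r) * Real.exp (-a) ^ hammingDist y z :=
        Finset.sum_le_sum_of_subset_of_nonneg (Finset.subset_univ _)
          fun z _ _ => Finset.sum_nonneg fun y _ => by positivity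
    _ = ∑ y ∈ B, Real.exp (a * r) * ∑ z, Real.exp (-a) ^ hammingDist y z := by
        rw [Finset.sum_comm]
        simp_rw [Finset.mul_sum]
    _ ≤ ∑ y ∈ B, Real.exp (a * r) * Real.exp (n * (Fintype.card Y * Real.exp (-a))) :=
        Finset.sum_le_sum fun y _ => mul_le_mul_of_nonneg_left
          (sum_pow_hammingDist_le y (Real.exp_pos _).le) (Real.exp_pos _).le
    _ = _ := by rw [Finset.sum_const, nsmul_eq_mul, ← Real.exp_add, mul_comm]

theorem isChannel.prodW_nonneg {X Y : Type*} [Fintype Y] {W : X → Y → ℝ} (hW : isChannel W)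
    {n : ℕ} (x : Fin n → X) (y : Fin n → Y) : 0 ≤ prodW W x y :=
  Finset.prod_nonneg fun _ _ => (hW _).1 _

theorem isChannel.sum_prodW {X Y : Type*} [Fintype Y] {W : X → Y → ℝ} (hW : isChannel W)
    {n : ℕ} (x : Fin n → X) : ∑ y, prodW W x y = 1 := by
  have h1 := Finset.prod_univ_sum (fun _ : Fin n => (Finset.univ : Finset Y))
    (fun j a => W (x j) a)
  rw [Fintype.piFinset_univ] at h1
  simp only [prodW, ← h1, (hW _).2, Finset.prod_const_one]

theorem isChannel.prodWSet_mul_compl_blowup_le {X Y : Type*} [Fintype Y] {W : X → Y → ℝ}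
    (hW : isChannel W) {n : ℕ} (x : Fin n → X) (B : Finset (Fin n → Y)) {δ : ℝ} (hδ : 0 ≤ δ) :
    prodWSet W x B * (1 - prodWSet W x (hammingBlowup B (n * δ))) ≤ Real.exp (-(n * δ ^ 2)) := by
  set B' := hammingBlowup B (n * δ)
  set Λ := Real.exp (2 * δ) with hΛdef
  have hΛ : 1 ≤ Λ := Real.one_le_exp (by linarith)
  have hset : ∀ S : Finset (Fin n → Y),
      prodWSet W x S = ∑ y, (∏ j, W (x j) (y j)) * if y ∈ S then 1 else 0 := fun S => by
    simp [prodWSet, prodW]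
  have hcompl : 1 - prodWSet W x B' =
      ∑ y, (∏ j, W (x j) (y j)) * if y ∈ B' then 0 else 1 := by
    rw [sub_eq_iff_eq_add, hset, ← Finset.sum_add_distrib]
    refine (hW.sum_prodW x).symm.trans (Finset.sum_congr rfl fun y _ => ?_)
    split_ifs <;> simp [prodW]
  have key := sum_prod_mul_sum_prod_le hΛ (w := fun j => W (x j)) (fun j => (hW _).1)
    (fun j => (hW _).2) (f := fun y => if y ∈ B then 1 else 0)
    (h := fun y => if y ∈ B' then 0 else 1) (C := Real.exp (-(2 * n * δ ^ 2)))
    (fun y => by split_ifs <;> simp) (fun y => by split_ifs <;> simp) (Real.exp_pos _).le ?_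
  · rw [hset, hcompl]
    refine key.trans ?_
    have hK : (1 + Λ) ^ 2 / (4 * Λ) ≤ Real.exp (δ ^ 2) := by
      have h1 : (1 + Λ) ^ 2 / (4 * Λ) = Real.cosh δ ^ 2 := by
        have h2 : Λ = Real.exp δ ^ 2 := by rw [hΛdef, ← Real.exp_nat_mul]; norm_num
        rw [h2, Real.cosh_eq, Real.exp_neg]
        field_simp
        ring
      rw [h1]
      calc Real.cosh δ ^ 2 ≤ Real.exp (δ ^ 2 / 2) ^ 2 := by
            have := Real.cosh_le_exp_half_sq δ
            have := Real.cosh_pos δ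
            gcongr
        _ = Real.exp (δ ^ 2) := by rw [← Real.exp_nat_mul]; congr 1; push_cast; ring
    calc _ ≤ Real.exp (-(2 * n * δ ^ 2)) * Real.exp (δ ^ 2) ^ n := by gcongr
      _ = _ := by rw [← Real.exp_nat_mul, ← Real.exp_add]; congr 1; ring
  · intro y z
    rw [prod_ite_eq_pow_hammingDist]
    by_cases hy : y ∈ B
    · by_cases hz : z ∈ B'
      · simp only [hz, if_true, mul_zero]; positivity
      · have hd : n * δ < hammingDist y z := by
          by_contra hcon
          exact hz (Finset.mem_filter.2 ⟨Finset.mem_univ _, y, hy, not_lt.1 hcon⟩)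
        simp only [hy, hz, if_true, if_false, mul_one]
        rw [hΛdef, ← Real.exp_nat_mul, ← Real.exp_add]
        exact Real.one_le_exp (by nlinarith)
    · simp only [hy, if_false, zero_mul]; positivity

/-- Blowing-up lemma: the level of an image can be raised from `τ` to `η` at a
subexponential cost in cardinality. -/
theorem isChannel.exists_blowup {X Y : Type*} [Fintype Y] [Nonempty Y] {W : X → Y → ℝ}
    (hW : isChannel W) {τ η ε : ℝ} (hτ : 0 < τ) (hη : η < 1) (hε : 0 < ε) :
    ∃ N : ℕ, ∀ n : ℕ, N ≤ n → ∀ B : Finset (Fin n → Y), ∃ B' : Finset (Fin n → Y),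
      (B'.card : ℝ) ≤ (2 : ℝ) ^ (n * ε) * B.card ∧
      ∀ x, τ ≤ prodWSet W x B → η ≤ prodWSet W x B' := by
  set c : ℝ := (Fintype.card Y : ℝ) with hc
  have hc0 : 0 < c := by rw [hc]; exact_mod_cast Fintype.card_pos
  set e := ε * Real.log 2 with he
  have he0 : 0 < e := mul_pos hε (Real.log_pos one_lt_two)
  set a := 2 * c / e with ha
  have ha0 : 0 < a := by positivity
  set δ := e / (2 * a) with hδ
  have hδ0 : 0 < δ := by positivity
  have hlim : Filter.Tendsto (fun n : ℕ => Real.exp (-δ ^ 2) ^ n) Filter.atTop (nhds 0) :=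
    tendsto_pow_atTop_nhds_zero_of_lt_one (Real.exp_pos _).le
      (by rw [Real.exp_lt_one_iff]; nlinarith)
  obtain ⟨N, hN⟩ := Filter.eventually_atTop.1
    (hlim.eventually_lt_const (mul_pos hτ (sub_pos.2 hη)))
  refine ⟨N, fun n hn B => ⟨hammingBlowup B (n * δ), ?_, fun x hx => ?_⟩⟩
  · refine (card_hammingBlowup_le B _ ha0.le).trans ?_
    rw [Real.rpow_def_of_pos two_pos]
    gcongr
    have h1 : c * Real.exp (-a) ≤ e / 2 := by
      rw [Real.exp_neg, ← div_eq_mul_inv, div_le_iff₀ (Real.exp_pos _)]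
      have h2 : a ≤ Real.exp a := by linarith [Real.add_one_le_exp a]
      have h3 : e / 2 * a = c := by rw [ha]; field_simp
      nlinarith
    have h4 : a * δ = e / 2 := by rw [hδ]; field_simp
    calc a * (n * δ) + n * (c * Real.exp (-a)) = n * (a * δ + c * Real.exp (-a)) := by ring
      _ ≤ n * (e / 2 + e / 2) := by rw [h4]; gcongr
      _ = Real.log 2 * (n * ε) := by rw [he]; ring
  · have h1 := hW.prodWSet_mul_compl_blowup_le x B hδ0.le
    have h2 := hN n hn
    rw [← Real.exp_nat_mul] at h2
    have h3 : Real.exp (n * -δ ^ 2) = Real.exp (-(n * δ ^ 2)) := by ring_nf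
    rw [h3] at h2
    by_contra hcon
    push Not at hcon
    nlinarith [mul_le_mul hx (sub_le_sub_left hcon.le 1) (sub_pos.2 hη).le (hτ.le.trans hx)]

theorem gimg_le {X Y : Type*} [Fintype Y] {W : X → Y → ℝ} {n : ℕ} {A : Finset (Fin n → X)}
    {η : ℝ} {B : Finset (Fin n → Y)} (hB : ∀ x ∈ A, η ≤ prodWSet W x B) :
    gimg W A η ≤ B.card :=
  Nat.sInf_le ⟨B, rfl, hB⟩

theorem isChannel.prodWSet_univ {X Y : Type*} [Fintype Y] {W : X → Y → ℝ} (hW : isChannel W)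
    {n : ℕ} (x : Fin n → X) : prodWSet W x Finset.univ = 1 :=
  hW.sum_prodW x

theorem isChannel.prodWSet_le_one {X Y : Type*} [Fintype Y] {W : X → Y → ℝ} (hW : isChannel W)
    {n : ℕ} (x : Fin n → X) (B : Finset (Fin n → Y)) : prodWSet W x B ≤ 1 :=
  (Finset.sum_le_sum_of_subset_of_nonneg (Finset.subset_univ _)
    fun y _ _ => hW.prodW_nonneg x y).trans_eq (hW.sum_prodW x)

theorem isChannel.exists_card_eq_gimg {X Y : Type*} [Fintype Y] {W : X → Y → ℝ}
    (hW : isChannel W) {n : ℕ} (A : Finset (Fin n → X)) {η : ℝ} (hη : η ≤ 1) :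
    ∃ B : Finset (Fin n → Y), B.card = gimg W A η ∧ ∀ x ∈ A, η ≤ prodWSet W x B :=
  Nat.sInf_mem (s := {m | ∃ B : Finset (Fin n → Y), B.card = m ∧ ∀ x ∈ A, η ≤ prodWSet W x B})
    ⟨_, Finset.univ, rfl, fun x _ => hη.trans_eq (hW.prodWSet_univ x).symm⟩

theorem isChannel.gimg_mono {X Y : Type*} [Fintype Y] {W : X → Y → ℝ}
    (hW : isChannel W) {n : ℕ} {A A' : Finset (Fin n → X)} (h : A' ⊆ A) {η : ℝ} (hη : η ≤ 1) :
    gimg W A' η ≤ gimg W A η := by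
  obtain ⟨B, hB, hAB⟩ := hW.exists_card_eq_gimg A hη
  exact hB ▸ gimg_le fun x hx => hAB x (h hx)

theorem isChannel.gimg_pos {X Y : Type*} [Fintype Y] {W : X → Y → ℝ}
    (hW : isChannel W) {n : ℕ} {A : Finset (Fin n → X)} (hA : A.Nonempty) {η : ℝ}
    (hη0 : 0 < η) (hη : η ≤ 1) : 0 < gimg W A η := by
  obtain ⟨B, hB, hAB⟩ := hW.exists_card_eq_gimg A hη
  obtain ⟨x, hx⟩ := hA
  rw [← hB, Finset.card_pos, Finset.nonempty_iff_ne_empty]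
  rintro rfl
  exact hη0.not_ge (by simpa [prodWSet] using hAB x hx)

theorem isChannel.logb_gimg_nonneg {X Y : Type*} [Fintype Y] {W : X → Y → ℝ}
    (hW : isChannel W) {n : ℕ} {A : Finset (Fin n → X)} (hA : A.Nonempty) {η : ℝ}
    (hη0 : 0 < η) (hη : η ≤ 1) : 0 ≤ Real.logb 2 (gimg W A η) :=
  Real.logb_nonneg one_lt_two (by exact_mod_cast hW.gimg_pos hA hη0 hη)

theorem isChannel.logb_gimg_le {X Y : Type*} [Fintype Y] {W : X → Y → ℝ}
    (hW : isChannel W) {n : ℕ} {A : Finset (Fin n → X)} (hA : A.Nonempty) {η : ℝ}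
    (hη0 : 0 < η) (hη : η ≤ 1) :
    Real.logb 2 (gimg W A η) ≤ n * Real.logb 2 (Fintype.card Y) := by
  rw [← Real.logb_pow]
  refine Real.logb_le_logb_of_le one_lt_two (by exact_mod_cast hW.gimg_pos hA hη0 hη) ?_
  have : gimg W A η ≤ (Finset.univ : Finset (Fin n → Y)).card :=
    gimg_le fun x _ => hη.trans_eq (hW.prodWSet_univ x).symm
  rw [Finset.card_univ, Fintype.card_fun, Fintype.card_fin] at this
  exact_mod_cast this

theorem ent_le_cross {Z : Type*} [Fintype Z] {p r : Z → ℝ} (hp : ∀ z, 0 ≤ p z)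
    (hr : ∀ z, 0 < r z) (h : ∑ z, r z ≤ ∑ z, p z) :
    ent p ≤ -∑ z, p z * Real.logb 2 (r z) := by
  have hl : 0 < Real.log 2 := Real.log_pos one_lt_two
  have hpt : ∀ z, p z * Real.logb 2 (r z) - p z * Real.logb 2 (p z) ≤
      (r z - p z) / Real.log 2 := by
    intro z
    rcases (hp z).eq_or_lt with h0 | h0
    · rw [← h0]
      simpa using div_nonneg (hr z).le hl.le
    · rw [le_div_iff₀ hl, Real.logb, Real.logb]
      have h1 := Real.log_le_sub_one_of_pos (div_pos (hr z) h0)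
      rw [Real.log_div (hr z).ne' h0.ne'] at h1
      calc _ = p z * (Real.log (r z) - Real.log (p z)) := by field_simp
        _ ≤ p z * (r z / p z - 1) := by gcongr
        _ = r z - p z := by field_simp
  have hs := Finset.sum_le_sum fun z (_ : z ∈ Finset.univ) => hpt z
  rw [Finset.sum_sub_distrib, ← Finset.sum_div, Finset.sum_sub_distrib] at hs
  have : (∑ z, r z - ∑ z, p z) / Real.log 2 ≤ 0 :=
    div_nonpos_of_nonpos_of_nonneg (by linarith) hl.le
  rw [ent]
  linarith

theorem ent_le_of_set {Z : Type*} [Fintype Z] {p : Z → ℝ} (hp : ∀ z, 0 ≤ p z)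
    (hp1 : ∑ z, p z = 1) {B : Finset Z} (hB : B.Nonempty) :
    ent p ≤ 1 + Real.logb 2 B.card + (1 - ∑ z ∈ B, p z) * Real.logb 2 (Fintype.card Z) := by
  have hb : (1 : ℝ) ≤ B.card := by exact_mod_cast hB.card_pos
  have hz : (1 : ℝ) ≤ Fintype.card Z := hb.trans (by exact_mod_cast B.card_le_univ)
  have hb0 : (0 : ℝ) < B.card := by linarith
  have hz0 : (0 : ℝ) < Fintype.card Z := by linarith
  set r : Z → ℝ := fun z =>
    (if z ∈ B then (2 * (B.card : ℝ))⁻¹ else 0) + (2 * (Fintype.card Z : ℝ))⁻¹ with hr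
  have hrpos : ∀ z, 0 < r z := fun z => by
    simp only [hr]
    split_ifs <;> positivity
  have hrsum : ∑ z, r z = 1 := by
    simp only [hr, Finset.sum_add_distrib, Finset.sum_ite_mem, Finset.univ_inter,
      Finset.sum_const, Finset.card_univ, nsmul_eq_mul]
    field_simp
    norm_num
  refine (ent_le_cross hp hrpos (by rw [hrsum, hp1])).trans ?_
  have hlog : ∀ c : ℝ, 0 < c → Real.logb 2 (2 * c)⁻¹ = -(1 + Real.logb 2 c) := fun c hc => by
    rw [Real.logb_inv, Real.logb_mul two_ne_zero hc.ne', Real.logb_self_eq_one one_lt_two]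
  have hpt : ∀ z, -(p z * Real.logb 2 (r z)) ≤ p z + (if z ∈ B then p z else 0) *
      Real.logb 2 B.card + (p z - if z ∈ B then p z else 0) * Real.logb 2 (Fintype.card Z) := by
    intro z
    by_cases hzB : z ∈ B
    · have h1 : -(1 + Real.logb 2 B.card) ≤ Real.logb 2 (r z) := by
        rw [← hlog _ hb0]
        refine Real.logb_le_logb_of_le one_lt_two (by positivity) ?_
        simp only [hr, hzB, if_true]
        exact le_add_of_nonneg_right (by positivity)
      simp only [hzB, if_true]
      nlinarith [mul_le_mul_of_nonneg_left h1 (hp z)]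
    · have h1 : Real.logb 2 (r z) = -(1 + Real.logb 2 (Fintype.card Z)) := by
        rw [← hlog _ hz0]
        simp only [hr, hzB, if_false, zero_add]
      simp only [hzB, if_false, h1]
      apply le_of_eq
      ring
  rw [← Finset.sum_neg_distrib]
  refine (Finset.sum_le_sum fun z _ => hpt z).trans ?_
  rw [Finset.sum_add_distrib, Finset.sum_add_distrib, ← Finset.sum_mul, ← Finset.sum_mul,
    Finset.sum_sub_distrib, Finset.sum_ite_mem, Finset.univ_inter, hp1]
  have hB1 : ∑ z ∈ B, p z ≤ 1 :=
    hp1 ▸ Finset.sum_le_sum_of_subset_of_nonneg (Finset.subset_univ _) fun z _ _ => hp z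
  nlinarith [mul_nonneg (sub_nonneg.2 hB1) (Real.logb_nonneg one_lt_two hb)]

theorem le_one_of_sum_eq_one {Z : Type*} [Fintype Z] {p : Z → ℝ} (hp : ∀ z, 0 ≤ p z)
    (hp1 : ∑ z, p z = 1) (z : Z) : p z ≤ 1 :=
  hp1 ▸ Finset.single_le_sum (fun z _ => hp z) (Finset.mem_univ z)

theorem ent_nonneg {Z : Type*} [Fintype Z] {p : Z → ℝ} (hp : ∀ z, 0 ≤ p z)
    (hp1 : ∑ z, p z = 1) : 0 ≤ ent p :=
  neg_nonneg.2 <| Finset.sum_nonpos fun z _ => mul_nonpos_of_nonneg_of_nonpos (hp z) <|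
    Real.logb_nonpos one_lt_two (hp z) (le_one_of_sum_eq_one hp hp1 z)

theorem le_ent_of_forall_card_le {Z : Type*} [Fintype Z] {p : Z → ℝ} (hp : ∀ z, 0 ≤ p z)
    (hp1 : ∑ z, p z = 1) {v t : ℝ} (hv : 0 ≤ v)
    (h : ∀ B : Finset Z, (B.card : ℝ) ≤ (2 : ℝ) ^ v → ∑ z ∈ B, p z ≤ t) :
    v * (1 - t) ≤ ent p := by
  set T : Finset Z := Finset.univ.filter fun z => (2 : ℝ) ^ (-v) < p z with hT
  have hcard : (T.card : ℝ) ≤ (2 : ℝ) ^ v := by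
    have h1 : (T.card : ℝ) * (2 : ℝ) ^ (-v) ≤ 1 := by
      rw [← nsmul_eq_mul, ← hp1]
      refine (Finset.card_nsmul_le_sum T p _ fun z hz => (Finset.mem_filter.1 hz).2.le).trans ?_
      exact Finset.sum_le_sum_of_subset_of_nonneg (Finset.subset_univ _) fun z _ _ => hp z
    rwa [Real.rpow_neg two_pos.le, ← div_eq_mul_inv, div_le_one (by positivity)] at h1
  have hpt : ∀ z, v * (p z - if z ∈ T then p z else 0) ≤ -(p z * Real.logb 2 (p z)) := by
    intro z
    have hz1 := le_one_of_sum_eq_one hp hp1 z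
    by_cases hz : z ∈ T
    · have := mul_nonpos_of_nonneg_of_nonpos (hp z) (Real.logb_nonpos one_lt_two (hp z) hz1)
      simp only [hz, if_true]
      linarith
    · simp only [hz, if_false, sub_zero]
      rcases (hp z).eq_or_lt with h0 | h0
      · simp [← h0]
      · have h2 : p z ≤ (2 : ℝ) ^ (-v) := by
          simpa [hT] using hz
        have h3 : Real.logb 2 (p z) ≤ -v := by
          rwa [Real.logb_le_iff_le_rpow one_lt_two h0]
        nlinarith
  have hs := Finset.sum_le_sum fun z (_ : z ∈ Finset.univ) => hpt z
  rw [← Finset.mul_sum, Finset.sum_sub_distrib, Finset.sum_ite_mem, Finset.univ_inter, hp1,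
    Finset.sum_neg_distrib] at hs
  exact le_trans (mul_le_mul_of_nonneg_left (sub_le_sub_left (h T hcard) 1) hv) hs

theorem isChannel.outDist_nonneg {X Y : Type*} [Fintype Y] {W : X → Y → ℝ} (hW : isChannel W)
    {n : ℕ} (A : Finset (Fin n → X)) (y : Fin n → Y) : 0 ≤ outDist W A y :=
  mul_nonneg (by positivity) (Finset.sum_nonneg fun _ _ => hW.prodW_nonneg _ _)

theorem sum_outDist {X Y : Type*} (W : X → Y → ℝ) {n : ℕ} (A : Finset (Fin n → X))
    (B : Finset (Fin n → Y)) :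
    ∑ y ∈ B, outDist W A y = (A.card : ℝ)⁻¹ * ∑ x ∈ A, prodWSet W x B := by
  simp only [outDist, prodWSet, ← Finset.mul_sum]
  rw [Finset.sum_comm]

theorem isChannel.sum_outDist_univ {X Y : Type*} [Fintype Y] {W : X → Y → ℝ}
    (hW : isChannel W) {n : ℕ} {A : Finset (Fin n → X)} (hA : A.Nonempty) :
    ∑ y, outDist W A y = 1 := by
  have : (A.card : ℝ) ≠ 0 := by exact_mod_cast hA.card_pos.ne'
  rw [sum_outDist]
  simp [hW.prodWSet_univ, this]

theorem isChannel.ent_outDist_le {X Y : Type*} [Fintype Y] [Nonempty Y] {W : X → Y → ℝ}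
    (hW : isChannel W) {η ε : ℝ} (hη : η ∈ Set.Ioo (0 : ℝ) 1) (hε : 0 < ε) :
    ∃ N : ℕ, ∀ n : ℕ, N ≤ n → ∀ A : Finset (Fin n → X), A.Nonempty →
      ent (outDist W A) ≤ Real.logb 2 (gimg W A η) + n * ε := by
  set L := Real.logb 2 (Fintype.card Y) with hL
  have hL0 : 0 ≤ L := Real.logb_nonneg one_lt_two (by exact_mod_cast Fintype.card_pos)
  set θ := ε / (1 + ε + 3 * L) with hθ
  have hd : 0 < 1 + ε + 3 * L := by positivity
  have hθ0 : 0 < θ := by positivity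
  have hθ1 : θ < 1 := by rw [hθ, div_lt_one hd]; linarith
  have hθL : θ * L ≤ ε / 3 := by
    rw [hθ, div_mul_eq_mul_div, div_le_iff₀ hd]
    nlinarith
  obtain ⟨N, hN⟩ := hW.exists_blowup (η := 1 - θ) hη.1 (by linarith) (show 0 < ε / 3 by positivity)
  obtain ⟨M, hM⟩ := exists_nat_gt (3 / ε)
  refine ⟨max N M, fun n hn A hA => ?_⟩
  have hn1 : 1 ≤ n * (ε / 3) := by
    have h1 : (M : ℝ) ≤ n := by exact_mod_cast (le_max_right _ _).trans hn
    have h2 := hM.le.trans h1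
    rw [div_le_iff₀ hε] at h2
    linarith
  obtain ⟨B, hB, hAB⟩ := hW.exists_card_eq_gimg A hη.2.le
  obtain ⟨B', hcard, hB'⟩ := hN n ((le_max_left _ _).trans hn) B
  have hAB' : ∀ x ∈ A, 1 - θ ≤ prodWSet W x B' := fun x hx => hB' x (hAB x hx)
  have hA0 : (0 : ℝ) < A.card := by exact_mod_cast hA.card_pos
  have hne : B'.Nonempty := by
    obtain ⟨x, hx⟩ := hA
    rw [Finset.nonempty_iff_ne_empty]
    rintro rfl
    have := hAB' x hx
    simp [prodWSet] at this
    linarith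
  have hmass : 1 - θ ≤ ∑ y ∈ B', outDist W A y := by
    rw [sum_outDist, ← div_eq_inv_mul, le_div_iff₀ hA0, mul_comm, ← nsmul_eq_mul]
    exact Finset.card_nsmul_le_sum _ _ _ hAB'
  have hlog : Real.logb 2 B'.card ≤ n * (ε / 3) + Real.logb 2 (gimg W A η) := by
    have hg : (0 : ℝ) < gimg W A η := by exact_mod_cast hW.gimg_pos hA hη.1 hη.2.le
    rw [hB] at hcard
    refine (Real.logb_le_logb_of_le one_lt_two (by exact_mod_cast hne.card_pos) hcard).trans_eq ?_
    rw [Real.logb_mul (by positivity) hg.ne', Real.logb_rpow two_pos (by norm_num)]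
  refine (ent_le_of_set (hW.outDist_nonneg A) (hW.sum_outDist_univ hA) hne).trans ?_
  rw [Fintype.card_fun, Fintype.card_fin, Nat.cast_pow, Real.logb_pow, ← hL]
  have h3 : (1 - ∑ y ∈ B', outDist W A y) * (n * L) ≤ n * (ε / 3) := by
    calc _ ≤ θ * (n * L) := by gcongr; linarith
      _ = n * (θ * L) := by ring
      _ ≤ _ := by gcongr
  linarith

theorem isChannel.le_ent_outDist {X Y : Type*} [Fintype Y] {W : X → Y → ℝ}
    (hW : isChannel W) {n : ℕ} {A : Finset (Fin n → X)} (hA : A.Nonempty) {v τ : ℝ}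
    (hv : 0 ≤ v) (hτ : 0 ≤ τ)
    (h : ∀ B : Finset (Fin n → Y), (B.card : ℝ) ≤ (2 : ℝ) ^ v →
      ((A.filter fun x => τ ≤ prodWSet W x B).card : ℝ) ≤ τ * A.card) :
    v * (1 - 2 * τ) ≤ ent (outDist W A) := by
  refine le_ent_of_forall_card_le (hW.outDist_nonneg A) (hW.sum_outDist_univ hA) hv
    fun B hB => ?_
  have hA0 : (0 : ℝ) < A.card := by exact_mod_cast hA.card_pos
  rw [sum_outDist, ← div_eq_inv_mul, div_le_iff₀ hA0]
  calc ∑ x ∈ A, prodWSet W x B ≤ ∑ x ∈ A, ((if τ ≤ prodWSet W x B then 1 else 0) + τ) := by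
        refine Finset.sum_le_sum fun x _ => ?_
        split_ifs with hx
        · linarith [hW.prodWSet_le_one x B]
        · linarith
    _ = (A.filter fun x => τ ≤ prodWSet W x B).card + τ * A.card := by
        rw [Finset.sum_add_distrib, Finset.sum_boole, Finset.sum_const, nsmul_eq_mul, mul_comm τ]
    _ ≤ 2 * τ * A.card := by linarith [h B hB]

/-- `A` is spread at scale `s` if no set smaller than the minimal `η`-images of `A` by a factor
`2 ^ s` has probability at least `τ` for more than a fraction `τ` of the inputs in `A`. -/
def IsSpread {ι X : Type*} {Y : ι → Type*} [∀ i, Fintype (Y i)] (W : (i : ι) → X → Y i → ℝ)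
    (η τ s : ℝ) {n : ℕ} (A : Finset (Fin n → X)) : Prop :=
  ∀ i, ∀ B : Finset (Fin n → Y i), (B.card : ℝ) * (2 : ℝ) ^ s ≤ gimg (W i) A η →
    ((A.filter fun x => τ ≤ prodWSet (W i) x B).card : ℝ) ≤ τ * A.card

theorem IsSpread.logb_gimg_le_ent {ι X : Type*} {Y : ι → Type*} [∀ i, Fintype (Y i)]
    {W : (i : ι) → X → Y i → ℝ} (hW : ∀ i, isChannel (W i)) {η τ s : ℝ}
    (hη : η ∈ Set.Ioo (0 : ℝ) 1) (hτ : 0 ≤ τ) (hs : 0 ≤ s) {n : ℕ} {A : Finset (Fin n → X)}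
    (hA : A.Nonempty) (h : IsSpread W η τ s A) (i : ι) :
    Real.logb 2 (gimg (W i) A η) ≤
      ent (outDist (W i) A) + s + 2 * τ * (n * Real.logb 2 (Fintype.card (Y i))) := by
  have hg : (0 : ℝ) < gimg (W i) A η := by exact_mod_cast (hW i).gimg_pos hA hη.1 hη.2.le
  have hgle := (hW i).logb_gimg_le hA hη.1 hη.2.le
  have hg0 := (hW i).logb_gimg_nonneg hA hη.1 hη.2.le
  rcases le_total (Real.logb 2 (gimg (W i) A η)) s with hgs | hgs
  · have := ent_nonneg ((hW i).outDist_nonneg A) ((hW i).sum_outDist_univ hA)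
    have := mul_nonneg (mul_nonneg zero_le_two hτ) (hg0.trans hgle)
    linarith
  · have h1 := (hW i).le_ent_outDist hA (sub_nonneg.2 hgs) hτ fun B hB => h i B ?_
    · nlinarith
    · rwa [Real.rpow_sub two_pos, Real.rpow_logb two_pos (by norm_num) hg,
        le_div_iff₀ (by positivity)] at hB

theorem exists_subset_of_not_isSpread {ι X : Type*} [Fintype ι] {Y : ι → Type*}
    [∀ i, Fintype (Y i)] {W : (i : ι) → X → Y i → ℝ} (hW : ∀ i, isChannel (W i)) {η τ s : ℝ}
    (hη : η ∈ Set.Ioo (0 : ℝ) 1) (hτ : 0 < τ) {n : ℕ}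
    (hblow : ∀ i, ∀ B : Finset (Fin n → Y i), ∃ B' : Finset (Fin n → Y i),
      (B'.card : ℝ) ≤ (2 : ℝ) ^ (s / 2) * B.card ∧
      ∀ x, τ ≤ prodWSet (W i) x B → η ≤ prodWSet (W i) x B')
    {A : Finset (Fin n → X)} (hA : A.Nonempty) (h : ¬ IsSpread W η τ s A) :
    ∃ A' ⊆ A, A'.Nonempty ∧ τ * A.card ≤ (A'.card : ℝ) ∧
      ∑ i, Real.logb 2 (gimg (W i) A' η) + s / 2 ≤ ∑ i, Real.logb 2 (gimg (W i) A η) := by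
  simp only [IsSpread, not_forall, not_le] at h
  obtain ⟨i, B, hBs, hBA⟩ := h
  have hA0 : (0 : ℝ) < A.card := by exact_mod_cast hA.card_pos
  set A' := A.filter fun x => τ ≤ prodWSet (W i) x B
  have hsub : A' ⊆ A := Finset.filter_subset _ _
  have hne : A'.Nonempty := by
    rw [← Finset.card_pos]
    exact_mod_cast (mul_pos hτ hA0).trans hBA
  have hpos : ∀ (C : Finset (Fin n → X)), C.Nonempty → ∀ j, (0 : ℝ) < gimg (W j) C η :=
    fun C hC j => by exact_mod_cast (hW j).gimg_pos hC hη.1 hη.2.le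
  refine ⟨A', hsub, hne, hBA.le, ?_⟩
  obtain ⟨B', hB', hlev⟩ := hblow i B
  have hmono : ∀ j, Real.logb 2 (gimg (W j) A' η) ≤ Real.logb 2 (gimg (W j) A η) := fun j =>
    Real.logb_le_logb_of_le one_lt_two (hpos A' hne j)
      (by exact_mod_cast (hW j).gimg_mono hsub hη.2.le)
  have hdrop : Real.logb 2 (gimg (W i) A' η) + s / 2 ≤ Real.logb 2 (gimg (W i) A η) := by
    have h1 : (gimg (W i) A' η : ℝ) ≤ (2 : ℝ) ^ (s / 2) * B.card :=
      le_trans (by exact_mod_cast gimg_le fun x hx => hlev x (Finset.mem_filter.1 hx).2) hB'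
    have h2 : (gimg (W i) A' η : ℝ) * (2 : ℝ) ^ (s / 2) ≤ gimg (W i) A η := by
      calc (gimg (W i) A' η : ℝ) * (2 : ℝ) ^ (s / 2)
          ≤ (2 : ℝ) ^ (s / 2) * B.card * (2 : ℝ) ^ (s / 2) := by gcongr
        _ = B.card * ((2 : ℝ) ^ (s / 2) * (2 : ℝ) ^ (s / 2)) := by ring
        _ = B.card * (2 : ℝ) ^ s := by rw [← Real.rpow_add two_pos, add_halves]
        _ ≤ _ := hBs
    have hg := hpos A' hne i
    have h3 := Real.logb_le_logb_of_le one_lt_two (by positivity) h2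
    rwa [Real.logb_mul hg.ne' (by positivity), Real.logb_rpow two_pos (by norm_num)] at h3
  rw [← Finset.add_sum_erase _ _ (Finset.mem_univ i),
    ← Finset.add_sum_erase (a := i) _ _ (Finset.mem_univ i), add_right_comm]
  exact add_le_add hdrop (Finset.sum_le_sum fun j _ => hmono j)

theorem exists_isSpread_subset {ι X : Type*} [Fintype ι] {Y : ι → Type*} [∀ i, Fintype (Y i)]
    {W : (i : ι) → X → Y i → ℝ} (hW : ∀ i, isChannel (W i)) {η τ s : ℝ}
    (hη : η ∈ Set.Ioo (0 : ℝ) 1) (hτ : 0 < τ) (hτ1 : τ ≤ 1) (hs : 0 < s) {n : ℕ}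
    (hblow : ∀ i, ∀ B : Finset (Fin n → Y i), ∃ B' : Finset (Fin n → Y i),
      (B'.card : ℝ) ≤ (2 : ℝ) ^ (s / 2) * B.card ∧
      ∀ x, τ ≤ prodWSet (W i) x B → η ≤ prodWSet (W i) x B')
    (J : ℕ) {A : Finset (Fin n → X)} (hA : A.Nonempty)
    (hJ : ∑ i, Real.logb 2 (gimg (W i) A η) ≤ J * (s / 2)) :
    ∃ A' ⊆ A, A'.Nonempty ∧ τ ^ J * A.card ≤ (A'.card : ℝ) ∧ IsSpread W η τ s A' := by
  induction J generalizing A with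
  | zero =>
    refine ⟨A, Finset.Subset.rfl, hA, by simp, ?_⟩
    by_contra hns
    obtain ⟨A', -, hA', -, hsum⟩ := exists_subset_of_not_isSpread hW hη hτ hblow hA hns
    have : 0 ≤ ∑ i, Real.logb 2 (gimg (W i) A' η) :=
      Finset.sum_nonneg fun i _ => (hW i).logb_gimg_nonneg hA' hη.1 hη.2.le
    rw [Nat.cast_zero, zero_mul] at hJ
    linarith
  | succ J ih =>
    by_cases hsp : IsSpread W η τ s A
    · refine ⟨A, Finset.Subset.rfl, hA, ?_, hsp⟩
      exact mul_le_of_le_one_left (by positivity) (pow_le_one₀ hτ.le hτ1)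
    · obtain ⟨A', hsub, hA', hcard, hsum⟩ := exists_subset_of_not_isSpread hW hη hτ hblow hA hsp
      push_cast at hJ
      obtain ⟨A'', hsub', hA'', hcard', hsp'⟩ := ih hA' (by linarith)
      refine ⟨A'', hsub'.trans hsub, hA'', ?_, hsp'⟩
      calc τ ^ (J + 1) * A.card = τ ^ J * (τ * A.card) := by ring
        _ ≤ τ ^ J * A'.card := by gcongr
        _ ≤ _ := hcard'

theorem exists_finpartition_of_forall_exists_subset {α : Type*} [DecidableEq α]
    {P : Finset α → Prop} {c : ℝ} (hc : 0 < c)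
    (h : ∀ A : Finset α, A.Nonempty → ∃ A' ⊆ A, A'.Nonempty ∧ c * A.card ≤ A'.card ∧ P A')
    (A : Finset α) (hA : A.Nonempty) :
    ∃ Q : Finpartition A, (∀ S ∈ Q.parts, P S) ∧
      (Q.parts.card : ℝ) ≤ 1 + Real.log A.card / c := by
  induction A using Finset.strongInduction with
  | H A ih =>
    obtain ⟨A', hsub, hne, hcard, hP⟩ := h A hA
    have hA0 : (0 : ℝ) < A.card := by exact_mod_cast hA.card_pos
    rcases (A \ A').eq_empty_or_nonempty with hR | hR
    · have hAA : A' = A := hsub.antisymm (Finset.sdiff_eq_empty_iff_subset.1 hR)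
      subst hAA
      refine ⟨Finpartition.indiscrete hne.ne_empty, by simpa using hP, ?_⟩
      simpa using div_nonneg (Real.log_natCast_nonneg _) hc.le
    · obtain ⟨Q, hQ, hQc⟩ := ih (A \ A') (Finset.sdiff_ssubset hsub hne) hR
      refine ⟨Q.extend (b := A') hne.ne_empty Finset.sdiff_disjoint
        (Finset.sdiff_union_of_subset hsub), ?_, ?_⟩
      · intro S hS
        rcases Finset.mem_insert.1 hS with rfl | hS
        · exact hP
        · exact hQ S hS
      · rw [Finpartition.card_extend, Nat.cast_add, Nat.cast_one]
        have hR0 : (0 : ℝ) < (A \ A').card := by exact_mod_cast hR.card_pos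
        have hRA : ((A \ A').card : ℝ) = A.card - A'.card := by
          rw [Finset.cast_card_sdiff hsub]
        have hlog : Real.log (A \ A').card ≤ Real.log A.card - c := by
          have h1 := Real.log_le_sub_one_of_pos (div_pos hR0 hA0)
          rw [Real.log_div hR0.ne' hA0.ne'] at h1
          have h2 : ((A \ A').card : ℝ) / A.card ≤ 1 - c := by
            rw [div_le_iff₀ hA0, hRA]; linarith
          linarith
        have h3 : Real.log (A \ A').card / c ≤ Real.log A.card / c - 1 := by
          rw [div_sub_one hc.ne']
          gcongr
        linarith

theorem ent_condUnif {X : Type*} [Fintype X] {n : ℕ} {A : Finset (Fin n → X)}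
    (hA : A.Nonempty) : ent (condUnif A) = Real.logb 2 A.card := by
  have hA0 : (A.card : ℝ) ≠ 0 := by exact_mod_cast hA.card_pos.ne'
  have : ∀ x, condUnif A x * Real.logb 2 (condUnif A x) =
      if x ∈ A then (A.card : ℝ)⁻¹ * -Real.logb 2 A.card else 0 := fun x => by
    simp only [condUnif]
    split_ifs <;> simp
  simp only [ent, this, Finset.sum_ite_mem, Finset.univ_inter, Finset.sum_const, nsmul_eq_mul]
  field_simp

open Filter in
/-- Theorem 2: eventually, every nonempty `A` may be partitioned into
at most `n·Γ` nonempty pieces, on each of which the image-size characterization coincides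
with the entropy characterization for all `D` channels. -/
theorem stmt_13 {X : Type*} [Fintype X] [Nonempty X]
    (D : ℕ) (hD : 1 ≤ D)
    (Y : Fin D → Type*) [∀ i, Fintype (Y i)] [∀ i, Nonempty (Y i)]
    (W : (i : Fin D) → X → Y i → ℝ) (hW : ∀ i, isChannel (W i))
    (η : ℝ) (hη : η ∈ Set.Ioo (0:ℝ) 1)
    (ε : ℝ) (hε : 0 < ε) :
    ∃ Γ : ℝ, 0 < Γ ∧
      ∃ N : ℕ, ∀ n : ℕ, N ≤ n → ∀ A : Finset (Fin n → X), A.Nonempty →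
        ∃ (m : ℕ) (𝒜 : Fin m → Finset (Fin n → X)),
          (m : ℝ) ≤ (n : ℝ) * Γ ∧
          (∀ k, (𝒜 k).Nonempty) ∧
          (∀ k l, k ≠ l → Disjoint (𝒜 k) (𝒜 l)) ∧
          Finset.univ.biUnion 𝒜 = A ∧
          ∀ k,
            ent (condUnif (𝒜 k)) = Real.logb 2 ((𝒜 k).card) ∧
            ∀ i : Fin D,
              |(1 / (n:ℝ)) * ent (outDist (W i) (𝒜 k)) -
                (1 / (n:ℝ)) * Real.logb 2 (gimg (W i) (𝒜 k) η)| ≤ ε := by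
  set L : Fin D → ℝ := fun i => Real.logb 2 (Fintype.card (Y i)) with hL
  have hL0 : ∀ i, 0 ≤ L i := fun i =>
    Real.logb_nonneg one_lt_two (by exact_mod_cast Fintype.card_pos)
  set S := ∑ i, L i
  have hLS : ∀ i, L i ≤ S := fun i => Finset.single_le_sum (fun i _ => hL0 i) (Finset.mem_univ i)
  have hS0 : 0 ≤ S := Finset.sum_nonneg fun i _ => hL0 i
  have hd : 0 < 1 + ε + 4 * S := by positivity
  set τ := ε / (1 + ε + 4 * S) with hτdef
  have hτ : 0 < τ := by positivity
  have hτ1 : τ ≤ 1 := by rw [hτdef, div_le_one hd]; linarith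
  have hτL : ∀ i, 2 * τ * L i ≤ ε / 2 := fun i => by
    rw [hτdef, mul_div_assoc', div_mul_eq_mul_div, div_le_iff₀ hd]
    nlinarith [hLS i]
  set J := ⌈S / (ε / 4)⌉₊
  have hJ : S ≤ J * (ε / 4) := (div_le_iff₀ (by positivity)).1 (Nat.le_ceil _)
  have hc : 0 < τ ^ J := by positivity
  have hX0 : 0 ≤ Real.log (Fintype.card X) := Real.log_natCast_nonneg _
  choose N₁ hN₁ using fun i => (hW i).exists_blowup hτ hη.2 (show 0 < ε / 4 by positivity)
  choose N₂ hN₂ using fun i => (hW i).ent_outDist_le hη hε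
  refine ⟨1 + Real.log (Fintype.card X) / τ ^ J, by positivity,
    max 1 (max (Finset.univ.sup N₁) (Finset.univ.sup N₂)), fun n hn A hA => ?_⟩
  simp only [max_le_iff, Finset.sup_le_iff, Finset.mem_univ, true_imp_iff] at hn
  obtain ⟨hn0, hn1, hn2⟩ := hn
  have hn0' : (1 : ℝ) ≤ n := by exact_mod_cast hn0
  have hnpos : (0 : ℝ) < n := by linarith
  have hblow : ∀ i, ∀ B : Finset (Fin n → Y i), ∃ B' : Finset (Fin n → Y i),
      (B'.card : ℝ) ≤ (2 : ℝ) ^ (n * (ε / 2) / 2) * B.card ∧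
      ∀ x, τ ≤ prodWSet (W i) x B → η ≤ prodWSet (W i) x B' := fun i B => by
    rw [show (n : ℝ) * (ε / 2) / 2 = n * (ε / 4) by ring]
    exact hN₁ i n (hn1 i) B
  obtain ⟨Q, hQ, hQc⟩ := exists_finpartition_of_forall_exists_subset
    (P := IsSpread W η τ (n * (ε / 2))) hc (fun C hC =>
      exists_isSpread_subset hW hη hτ hτ1 (by positivity) hblow J hC (by
        calc ∑ i, Real.logb 2 (gimg (W i) C η) ≤ ∑ i, n * L i :=
              Finset.sum_le_sum fun i _ => (hW i).logb_gimg_le hC hη.1 hη.2.le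
          _ = n * S := by rw [← Finset.mul_sum]
          _ ≤ n * (J * (ε / 4)) := by gcongr
          _ = J * (n * (ε / 2) / 2) := by ring)) A hA
  refine ⟨Q.parts.card, fun k => (Q.parts.equivFin.symm k).1, ?_, fun k => ?_, fun k l hkl => ?_,
    ?_, fun k => ?_⟩
  · refine hQc.trans ?_
    have hlog : Real.log A.card ≤ n * Real.log (Fintype.card X) := by
      rw [← Real.log_pow]
      refine Real.log_le_log (by exact_mod_cast hA.card_pos) ?_
      have := A.card_le_univ
      rw [Fintype.card_fun, Fintype.card_fin] at this
      exact_mod_cast this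
    calc 1 + Real.log A.card / τ ^ J ≤ n + n * Real.log (Fintype.card X) / τ ^ J := by gcongr
      _ = _ := by ring
  · exact Q.nonempty_of_mem_parts (Q.parts.equivFin.symm k).2
  · exact Q.disjoint (Q.parts.equivFin.symm k).2 (Q.parts.equivFin.symm l).2
      fun h => hkl (Q.parts.equivFin.symm.injective (Subtype.ext h))
  · ext x
    simp only [Finset.mem_biUnion, Finset.mem_univ, true_and]
    refine ⟨fun ⟨k, hk⟩ => Q.le (Q.parts.equivFin.symm k).2 hk, fun hx => ?_⟩
    obtain ⟨t, ht, hxt⟩ := Q.exists_mem hx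
    exact ⟨Q.parts.equivFin ⟨t, ht⟩, by simpa using hxt⟩
  · have hmem := (Q.parts.equivFin.symm k).2
    have hne := Q.nonempty_of_mem_parts hmem
    refine ⟨ent_condUnif hne, fun i => ?_⟩
    have hupper := hN₂ i n (hn2 i) _ hne
    have hlower := (hQ _ hmem).logb_gimg_le_ent hW hη hτ.le (by positivity) hne i
    rw [← mul_sub, abs_mul, abs_of_pos (by positivity), one_div, inv_mul_le_iff₀ hnpos, abs_le]
    have := mul_le_mul_of_nonneg_left (hτL i) hnpos.le
    constructor
    · linarith
    · linarith
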